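/- arXiv:1506.00090 — 7 statements merged into one kernel-verified Lean document; each statement's English description precedes it below -/
import Mathlib

section
/- An L-structure A is equational Artinian if and only if for every natural number n and every subset E ⊆ Aⁿ there exists a finite subset E₀ ⊆ E such that Rad(E) = Rad(E₀). -/
open FirstOrder

/-- The solution set in `A` of a system `S` of equations in `n` variables. -/
def VSet (L : FirstOrder.Language) (A : Type*) [L.Structure A] {n : ℕ}
    (S : Set (L.Term (Fin n) × L.Term (Fin n))) : Set (Fin n → A) :=
  { a | ∀ pq ∈ S, pq.1.realize a = pq.2.realize a }

/-- A subset of `Aⁿ` is an algebraic set if it is the solution set of some system. -/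
def IsAlgebraicSet (L : FirstOrder.Language) (A : Type*) [L.Structure A] {n : ℕ}
    (Y : Set (Fin n → A)) : Prop :=
  ∃ S, Y = VSet L A S

/-- The radical of a subset `E ⊆ Aⁿ`. -/
def Rad (L : FirstOrder.Language) (A : Type*) [L.Structure A] {n : ℕ}
    (E : Set (Fin n → A)) : Set (L.Term (Fin n) × L.Term (Fin n)) :=
  { pq | ∀ a ∈ E, pq.1.realize a = pq.2.realize a }

/-- An `A`-radical ideal of the term algebra. -/
def IsRadicalIdeal (L : FirstOrder.Language) (A : Type*) [L.Structure A] {n : ℕ}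
    (R : Set (L.Term (Fin n) × L.Term (Fin n))) : Prop :=
  ∃ E : Set (Fin n → A), R = Rad L A E

/-- `A` is equational Artinian: every ascending chain of algebraic sets stabilizes. -/
def EquationalArtinian (L : FirstOrder.Language) (A : Type*) [L.Structure A] : Prop :=
  ∀ (n : ℕ) (Y : ℕ → Set (Fin n → A)),
    (∀ i, IsAlgebraicSet L A (Y i)) → (∀ i, Y i ⊆ Y (i + 1)) →
    ∃ N, ∀ m, N ≤ m → Y m = Y N

/-- The radical topology on atomic formulas: closed sets are arbitrary intersections of
finite unions of `A`-radical ideals. -/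
def radicalTopology (L : FirstOrder.Language) (A : Type*) [L.Structure A] (n : ℕ) :
    TopologicalSpace (L.Term (Fin n) × L.Term (Fin n)) :=
  TopologicalSpace.generateFrom { U | IsRadicalIdeal L A Uᶜ }

/-- The Zariski topology on `Aⁿ`: closed sets are arbitrary intersections of
finite unions of algebraic sets. -/
def zariskiTopology (L : FirstOrder.Language) (A : Type*) [L.Structure A] (n : ℕ) :
    TopologicalSpace (Fin n → A) :=
  TopologicalSpace.generateFrom { U | IsAlgebraicSet L A Uᶜ }

section

variable {L : FirstOrder.Language} {A : Type*} [L.Structure A] {n : ℕ}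

theorem subset_VSet_iff_subset_Rad {E : Set (Fin n → A)}
    {S : Set (L.Term (Fin n) × L.Term (Fin n))} : E ⊆ VSet L A S ↔ S ⊆ Rad L A E :=
  ⟨fun h pq hpq _ ha => h ha pq hpq, fun h _ ha _ hpq => h hpq _ ha⟩

theorem Rad_anti {E F : Set (Fin n → A)} (h : E ⊆ F) : Rad L A F ⊆ Rad L A E :=
  fun _ hpq a ha => hpq a (h ha)

theorem VSet_anti {S T : Set (L.Term (Fin n) × L.Term (Fin n))} (h : S ⊆ T) :
    VSet L A T ⊆ VSet L A S :=
  fun _ ha pq hpq => ha pq (h hpq)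

theorem subset_VSet_Rad (E : Set (Fin n → A)) : E ⊆ VSet L A (Rad L A E) :=
  subset_VSet_iff_subset_Rad.2 subset_rfl

theorem IsAlgebraicSet.VSet_Rad {Y : Set (Fin n → A)} (hY : IsAlgebraicSet L A Y) :
    VSet L A (Rad L A Y) = Y := by
  obtain ⟨S, rfl⟩ := hY
  exact (VSet_anti (subset_VSet_iff_subset_Rad.1 subset_rfl)).antisymm (subset_VSet_Rad _)

theorem EquationalArtinian.wellFoundedGT (h : EquationalArtinian L A) (n : ℕ) :
    WellFoundedGT { Y : Set (Fin n → A) // IsAlgebraicSet L A Y } := by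
  rw [wellFoundedGT_iff_monotone_chain_condition]
  intro f
  obtain ⟨N, hN⟩ := h n (fun i => (f i).1) (fun i => (f i).2) fun i => f.monotone i.le_succ
  exact ⟨N, fun m hm => Subtype.ext (hN m hm).symm⟩

theorem EquationalArtinian.exists_finite_Rad_eq (h : EquationalArtinian L A)
    (E : Set (Fin n → A)) : ∃ E₀ ⊆ E, E₀.Finite ∧ Rad L A E = Rad L A E₀ := by
  have := h.wellFoundedGT n
  let cl (F : Set (Fin n → A)) : { Y : Set (Fin n → A) // IsAlgebraicSet L A Y } :=
    ⟨VSet L A (Rad L A F), _, rfl⟩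
  obtain ⟨_, ⟨E₀, ⟨hE₀, hfin⟩, rfl⟩, hmax⟩ := wellFounded_gt.has_min
    (cl '' { F | F ⊆ E ∧ F.Finite }) ⟨_, ∅, ⟨E.empty_subset, Set.finite_empty⟩, rfl⟩
  refine ⟨E₀, hE₀, hfin, (Rad_anti hE₀).antisymm ?_⟩
  refine subset_VSet_iff_subset_Rad.1 fun a ha => ?_
  have hle : cl E₀ ≤ cl (insert a E₀) := VSet_anti (Rad_anti (Set.subset_insert a E₀))
  have heq : cl E₀ = cl (insert a E₀) := hle.eq_of_not_lt
    (hmax _ ⟨_, ⟨Set.insert_subset ha hE₀, hfin.insert a⟩, rfl⟩)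
  change a ∈ (cl E₀).1
  rw [heq]
  exact subset_VSet_Rad _ (Set.mem_insert a E₀)

theorem equationalArtinian_of_exists_finite_Rad_eq
    (h : ∀ (n : ℕ) (E : Set (Fin n → A)),
      ∃ E₀ ⊆ E, E₀.Finite ∧ Rad L A E = Rad L A E₀) : EquationalArtinian L A := by
  intro n Y hY hmono
  have hmono : Monotone Y := monotone_nat_of_le_succ hmono
  obtain ⟨E₀, hE₀, hfin, hRad⟩ := h n (⋃ i, Y i)
  obtain ⟨N, hN⟩ := hmono.directed_le.exists_mem_subset_of_finset_subset_biUnion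
    (s := hfin.toFinset) (by simpa using hE₀)
  rw [hfin.coe_toFinset] at hN
  refine ⟨N, fun m hm => Set.Subset.antisymm ?_ (hmono hm)⟩
  calc Y m ⊆ ⋃ i, Y i := Set.subset_iUnion Y m
    _ ⊆ VSet L A (Rad L A (⋃ i, Y i)) := subset_VSet_Rad _
    _ ⊆ VSet L A (Rad L A (Y N)) := by
      rw [hRad]
      exact VSet_anti (Rad_anti hN)
    _ = Y N := (hY N).VSet_Rad

end

/-- `A` is equational Artinian iff for every `n` and every `E ⊆ Aⁿ` there is a
finite `E₀ ⊆ E` with `Rad(E) = Rad(E₀)`. -/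
theorem equationalArtinian_iff_finite_radical_subset
    {L : FirstOrder.Language} (A : Type*) [L.Structure A]
    (hL : ∀ k, IsEmpty (L.Relations k)) :
    EquationalArtinian L A ↔
      ∀ (n : ℕ) (E : Set (Fin n → A)),
        ∃ E₀ ⊆ E, E₀.Finite ∧ Rad L A E = Rad L A E₀ := by
  exact ⟨fun h _ E => h.exists_finite_Rad_eq E, equationalArtinian_of_exists_finite_Rad_eq⟩
end

section
/- An L-structure A is equational Artinian if and only if for every natural number n, the radical topology with respect to A on At_L(x₁,…,xₙ) is a noetherian topological space (every descending chain of closed subsets stabilizes). -/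
open FirstOrder

section

variable {L : FirstOrder.Language} {A : Type*} [L.Structure A] {n : ℕ}

theorem VSet_antitone : Antitone (VSet L A (n := n)) :=
  fun _ _ h _ ha pq hpq => ha pq (h hpq)

theorem Rad_antitone : Antitone (Rad L A (n := n)) :=
  fun _ _ h _ hpq a ha => hpq a (h ha)

theorem Rad_VSet_Rad (E : Set (Fin n → A)) : Rad L A (VSet L A (Rad L A E)) = Rad L A E :=
  Set.Subset.antisymm (fun _ hpq a ha => hpq a fun _ h => h a ha)
    fun pq hpq _ ha => ha pq hpq

theorem IsRadicalIdeal.Rad_VSet {R : Set (L.Term (Fin n) × L.Term (Fin n))}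
    (hR : IsRadicalIdeal L A R) : Rad L A (VSet L A R) = R := by
  obtain ⟨E, rfl⟩ := hR
  exact Rad_VSet_Rad E

theorem isRadicalIdeal_univ :
    IsRadicalIdeal L A (Set.univ : Set (L.Term (Fin n) × L.Term (Fin n))) :=
  ⟨∅, by simp [Rad]⟩

theorem IsRadicalIdeal.inter {R R' : Set (L.Term (Fin n) × L.Term (Fin n))}
    (hR : IsRadicalIdeal L A R) (hR' : IsRadicalIdeal L A R') :
    IsRadicalIdeal L A (R ∩ R') := by
  obtain ⟨E, rfl⟩ := hR
  obtain ⟨E', rfl⟩ := hR'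
  refine ⟨E ∪ E', ?_⟩
  ext pq
  simp [Rad, or_imp, forall_and]

theorem IsRadicalIdeal.isClosed {R : Set (L.Term (Fin n) × L.Term (Fin n))}
    (hR : IsRadicalIdeal L A R) : @IsClosed _ (radicalTopology L A n) R := by
  let _ := radicalTopology L A n
  refine isOpen_compl_iff.mp (TopologicalSpace.isOpen_generateFrom_of_mem ?_)
  simpa using hR

theorem EquationalArtinian.wellFoundedLT_radicalIdeal (h : EquationalArtinian L A) (n : ℕ) :
    WellFoundedLT { R : Set (L.Term (Fin n) × L.Term (Fin n)) // IsRadicalIdeal L A R } := by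
  rw [← wellFoundedGT_dual_iff, wellFoundedGT_iff_monotone_chain_condition]
  intro a
  let R : ℕ → { R : Set (L.Term (Fin n) × L.Term (Fin n)) // IsRadicalIdeal L A R } :=
    fun i => OrderDual.ofDual (a i)
  obtain ⟨N, hN⟩ := h n (fun i => VSet L A (R i).1) (fun i => ⟨_, rfl⟩)
    fun i => VSet_antitone (a.monotone (Nat.le_succ i))
  refine ⟨N, fun m hm => OrderDual.ofDual_inj.mp (Subtype.ext ?_)⟩
  have := congrArg (Rad L A) (hN m hm)
  rw [(R m).2.Rad_VSet, (R N).2.Rad_VSet] at this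
  exact this.symm

theorem EquationalArtinian.noetherianSpace (h : EquationalArtinian L A) (n : ℕ) :
    @TopologicalSpace.NoetherianSpace _ (radicalTopology L A n) := by
  let _ := radicalTopology L A n
  rw [TopologicalSpace.noetherianSpace_iff_isCompact]
  intro K
  refine isCompact_generateFrom rfl fun P hP hK => ?_
  have := h.wellFoundedLT_radicalIdeal n
  obtain ⟨R, ⟨Q, hQP, hQ, hRQ⟩, hmin⟩ := WellFounded.has_min
    (wellFounded_lt : WellFounded
      (α := { R : Set (L.Term (Fin n) × L.Term (Fin n)) // IsRadicalIdeal L A R }) (· < ·))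
    {R | ∃ Q ⊆ P, Q.Finite ∧ R.1 = (⋃₀ Q)ᶜ}
    ⟨⟨Set.univ, isRadicalIdeal_univ⟩, ∅, Set.empty_subset P, Set.finite_empty, by simp⟩
  refine ⟨Q, hQP, hQ, fun x hx => ?_⟩
  obtain ⟨U, hUP, hxU⟩ := hK hx
  by_contra hxQ
  have hxR : x ∈ R.1 := hRQ ▸ hxQ
  refine hmin ⟨R.1 ∩ Uᶜ, R.2.inter (hP hUP)⟩ ⟨insert U Q, Set.insert_subset hUP hQP,
    hQ.insert U, ?_⟩ (lt_of_le_not_ge Set.inter_subset_left fun hle => (hle hxR).2 hxU)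
  simp only [hRQ, Set.sUnion_insert, Set.compl_union, Set.inter_comm]

end

theorem TopologicalSpace.NoetherianSpace.exists_closed_chain_stable {X : Type*}
    [TopologicalSpace X] [NoetherianSpace X] (C : ℕ → Set X) (hC : ∀ i, IsClosed (C i))
    (hanti : Antitone C) : ∃ N, ∀ m, N ≤ m → C m = C N := by
  obtain ⟨N, hN⟩ := WellFoundedGT.monotone_chain_condition (α := Opens X)
    ⟨fun i => ⟨(C i)ᶜ, (hC i).isOpen_compl⟩, fun _ _ h => Set.compl_subset_compl.mpr (hanti h)⟩
  exact ⟨N, fun m hm => compl_injective (congrArg SetLike.coe (hN m hm)).symm⟩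

/-- `A` is equational Artinian iff for every `n` the radical topology with
respect to `A` is noetherian: every descending chain of closed sets stabilizes. -/
theorem equationalArtinian_iff_radicalTopology_noetherian
    {L : FirstOrder.Language} (A : Type*) [L.Structure A]
    (hL : ∀ k, IsEmpty (L.Relations k)) :
    EquationalArtinian L A ↔
      ∀ (n : ℕ) (C : ℕ → Set (L.Term (Fin n) × L.Term (Fin n))),
        (∀ i, @IsClosed _ (radicalTopology L A n) (C i)) → (∀ i, C (i + 1) ⊆ C i) →
        ∃ N, ∀ m, N ≤ m → C m = C N := by
  refine ⟨fun h n C hC hanti => ?_, fun h n Y hY hmono => ?_⟩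
  · let _ := radicalTopology L A n
    have := h.noetherianSpace n
    exact this.exists_closed_chain_stable C hC (antitone_nat_of_succ_le hanti)
  · obtain ⟨N, hN⟩ := h n (fun i => Rad L A (Y i))
      (fun i => IsRadicalIdeal.isClosed ⟨_, rfl⟩) fun i => Rad_antitone (hmono i)
    refine ⟨N, fun m hm => ?_⟩
    have := congrArg (VSet L A) (hN m hm)
    rwa [(hY m).VSet_Rad, (hY N).VSet_Rad] at this
end

section
/- Every substructure of an equational Artinian L-structure is equational Artinian. -/
open FirstOrder

theorem vSet_rad_of_isAlgebraicSet {L : FirstOrder.Language} {A : Type*} [L.Structure A] {n : ℕ}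
    {Y : Set (Fin n → A)} (hY : IsAlgebraicSet L A Y) : VSet L A (Rad L A Y) = Y := by
  obtain ⟨T, rfl⟩ := hY
  exact Set.Subset.antisymm (fun a ha pq hpq => ha pq fun b hb => hb pq hpq)
    fun a ha pq hpq => hpq a ha

theorem vSet_substructure {L : FirstOrder.Language} {A : Type*} [L.Structure A]
    (S : L.Substructure A) {n : ℕ} (T : Set (L.Term (Fin n) × L.Term (Fin n))) :
    VSet L S T = (fun a : Fin n → S => fun i => (a i : A)) ⁻¹' VSet L A T := by
  have realize_coe (t : L.Term (Fin n)) (a : Fin n → S) :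
      t.realize (fun i => (a i : A)) = ((t.realize a : S) : A) :=
    FirstOrder.Language.HomClass.realize_term S.subtype
  ext a
  simp only [VSet, Set.mem_preimage, Set.mem_ofPred_eq, realize_coe, Subtype.coe_inj]

/-- every substructure of an equational Artinian structure is equational
Artinian. -/
theorem equationalArtinian_substructure
    {L : FirstOrder.Language} (A : Type*) [L.Structure A]
    (hL : ∀ k, IsEmpty (L.Relations k))
    (hA : EquationalArtinian L A) (S : L.Substructure A) :
    EquationalArtinian L S := by
  intro n Y hY hmono
  obtain ⟨N, hN⟩ := hA n (fun i => VSet L A (Rad L S (Y i))) (fun i => ⟨_, rfl⟩)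
    fun i a ha pq hpq => ha pq fun b hb => hpq b (hmono i hb)
  refine ⟨N, fun m hm => ?_⟩
  rw [← vSet_rad_of_isAlgebraicSet (hY m), ← vSet_rad_of_isAlgebraicSet (hY N),
    vSet_substructure, vSet_substructure, hN m hm]
end

section
/- Let A be an equational Artinian L-structure, n a natural number, and Y ⊆ Aⁿ. Then the algebra of term functions on Y, i.e., the substructure of the L-structure of all functions Y → A (with pointwise operations) generated by the n coordinate projections Y → A, is equational Artinian. (This algebra is isomorphic to the coordinate algebra Γ(Y) = T_L(x₁,…,xₙ)/Rad(Y); hence every coordinate algebra over an equational Artinian algebra is equational Artinian.) -/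
open FirstOrder

/-- The pointwise `L`-structure on a function type `Y → A`. -/
instance funPointwiseStructure (L : FirstOrder.Language) (Y : Type*) (A : Type*)
    [L.Structure A] : L.Structure (Y → A) where
  funMap f x a := FirstOrder.Language.Structure.funMap f fun i => x i a
  RelMap r x := ∀ a, FirstOrder.Language.Structure.RelMap r fun i => x i a

/-- Evaluation at a point, as a homomorphism from the pointwise structure. -/
def funPointwiseEval (L : FirstOrder.Language) {Y A : Type*} [L.Structure A] (y : Y) :
    (Y → A) →[L] A where
  toFun f := f y
  map_fun' _ _ := rfl
  map_rel' _ _ h := h y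

/-- Taking radicals reverses inclusions. -/
theorem rad_antitone (L : FirstOrder.Language) (A : Type*) [L.Structure A] {n : ℕ} :
    Antitone (Rad L A (n := n)) :=
  fun _ _ h _ hpq a ha => hpq a (h ha)

/-- Taking solution sets reverses inclusions. -/
theorem vSet_antitone (L : FirstOrder.Language) (A : Type*) [L.Structure A] {n : ℕ} :
    Antitone (VSet L A (n := n)) :=
  fun _ _ h _ ha pq hpq => ha pq (h hpq)

/-- If homomorphisms `B → A` jointly separate the points of `B`, then an algebraic set over `B`
is determined by the solution set of its radical in `A`. -/
theorem IsAlgebraicSet.mem_iff_forall_comp_mem {L : FirstOrder.Language} {A B ι : Type*}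
    [L.Structure A] [L.Structure B] (φ : ι → B →[L] A)
    (hφ : ∀ b c : B, (∀ i, φ i b = φ i c) → b = c) {n : ℕ} {Z : Set (Fin n → B)}
    (hZ : IsAlgebraicSet L B Z) (b : Fin n → B) :
    b ∈ Z ↔ ∀ i, φ i ∘ b ∈ VSet L A (Rad L B Z) := by
  constructor
  · intro hb i pq hpq
    simp only [Language.HomClass.realize_term, hpq b hb]
  · intro h
    obtain ⟨S, rfl⟩ := hZ
    intro pq hpq
    refine hφ _ _ fun i => ?_
    simpa only [Language.HomClass.realize_term] using h i pq fun a ha => ha pq hpq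

/-- A structure whose points are separated by homomorphisms to an equational Artinian structure
is equational Artinian. -/
theorem EquationalArtinian.of_separating_homs {L : FirstOrder.Language} {A B ι : Type*}
    [L.Structure A] [L.Structure B] (hA : EquationalArtinian L A) (φ : ι → B →[L] A)
    (hφ : ∀ b c : B, (∀ i, φ i b = φ i c) → b = c) : EquationalArtinian L B := by
  intro n Z hZ hmono
  obtain ⟨N, hN⟩ := hA n (fun i => VSet L A (Rad L B (Z i))) (fun i => ⟨_, rfl⟩)
    fun i => vSet_antitone L A (rad_antitone L B (hmono i))
  refine ⟨N, fun m hm => Set.ext fun b => ?_⟩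
  have hm' : VSet L A (Rad L B (Z m)) = VSet L A (Rad L B (Z N)) := hN m hm
  rw [(hZ m).mem_iff_forall_comp_mem φ hφ, (hZ N).mem_iff_forall_comp_mem φ hφ, hm']

/-- for `A` equational Artinian and `Y ⊆ Aⁿ`, the algebra of term
functions on `Y`, i.e. the substructure of the pointwise structure on `Y → A` generated
by the coordinate projections, is equational Artinian. -/
theorem equationalArtinian_coordinateAlgebra
    {L : FirstOrder.Language} (A : Type*) [L.Structure A]
    (hL : ∀ k, IsEmpty (L.Relations k))
    (hA : EquationalArtinian L A) (n : ℕ) (Y : Set (Fin n → A)) :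
    EquationalArtinian L
      (FirstOrder.Language.Substructure.closure L
        (Set.range fun i : Fin n => fun a : Y => (a : Fin n → A) i)) := by
  exact hA.of_separating_homs
    (fun y : Y => (funPointwiseEval L y).comp (Language.Substructure.subtype _).toHom)
    fun b c h => Subtype.ext (funext h)
end

section
/- Let A be an equational Artinian L-structure and n a natural number. Then every nonempty irreducible closed subset of At_L(x₁,…,xₙ) in the radical topology with respect to A is an A-radical ideal, i.e., equals Rad(Y) for some Y ⊆ Aⁿ. -/
open FirstOrder

theorem rad_vSet_subset_of_isRadicalIdeal {L : FirstOrder.Language} {A : Type*} [L.Structure A]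
    {n : ℕ} {C R : Set (L.Term (Fin n) × L.Term (Fin n))} (hR : IsRadicalIdeal L A R)
    (hCR : C ⊆ R) : Rad L A (VSet L A C) ⊆ R := by
  obtain ⟨E, rfl⟩ := hR
  exact fun _ hpq a ha => hpq a fun _ hrs => hCR hrs a ha

theorem subset_rad_vSet {L : FirstOrder.Language} {A : Type*} [L.Structure A]
    {n : ℕ} (C : Set (L.Term (Fin n) × L.Term (Fin n))) : C ⊆ Rad L A (VSet L A C) :=
  fun pq hpq _ ha => ha pq hpq

/-- In a topology generated by a family `S`, a point outside an irreducible closed set `C`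
is separated from `C` by a single member of `S`. -/
theorem IsIrreducible.exists_mem_subbasis {X : Type*} [t : TopologicalSpace X] {S : Set (Set X)}
    (hS : t = TopologicalSpace.generateFrom S) {C : Set X} (hirr : IsIrreducible C)
    (hC : IsClosed C) {x : X} (hx : x ∉ C) : ∃ U ∈ S, x ∈ U ∧ C ⊆ Uᶜ := by
  obtain ⟨_, ⟨f, ⟨hfin, hfS⟩, rfl⟩, hxf, hfC⟩ :=
    (TopologicalSpace.isTopologicalBasis_of_subbasis hS).exists_subset_of_mem_open
      (show x ∈ Cᶜ from hx) hC.isOpen_compl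
  by_contra! h
  obtain ⟨y, hyC, hyf⟩ := isIrreducible_iff_sInter.1 hirr hfin.toFinset
    (fun u hu => by
      rw [hS]
      exact .basic u (hfS (hfin.mem_toFinset.1 hu)))
    (fun u hu => by
      have hu' := hfin.mem_toFinset.1 hu
      obtain ⟨y, hyC, hyu⟩ := Set.not_subset.1 (h u (hfS hu') (hxf u hu'))
      exact ⟨y, hyC, not_not.1 hyu⟩)
  rw [hfin.coe_toFinset] at hyf
  exact hfC hyf hyC

/-- for `A` equational Artinian, every nonempty irreducible closed subset
of the radical topology is an `A`-radical ideal. -/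
theorem irreducible_closed_isRadicalIdeal
    {L : FirstOrder.Language} (A : Type*) [L.Structure A]
    (hL : ∀ k, IsEmpty (L.Relations k))
    (hA : EquationalArtinian L A) (n : ℕ)
    (C : Set (L.Term (Fin n) × L.Term (Fin n)))
    (hC : @IsClosed _ (radicalTopology L A n) C) (hne : C.Nonempty)
    (hirr : ¬ ∃ C₁ C₂ : Set (L.Term (Fin n) × L.Term (Fin n)),
      @IsClosed _ (radicalTopology L A n) C₁ ∧ @IsClosed _ (radicalTopology L A n) C₂ ∧
      C₁ ⊂ C ∧ C₂ ⊂ C ∧ C = C₁ ∪ C₂) :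
    IsRadicalIdeal L A C := by
  let := radicalTopology L A n
  have hC_irr : IsIrreducible C := by
    refine ⟨hne, isPreirreducible_iff_isClosed_union_isClosed.2 fun C₁ C₂ h₁ h₂ hsub => ?_⟩
    by_contra! h
    exact hirr ⟨C ∩ C₁, C ∩ C₂, hC.inter h₁, hC.inter h₂,
      ⟨Set.inter_subset_left, fun hs => h.1 fun _ hx => (hs hx).2⟩,
      ⟨Set.inter_subset_left, fun hs => h.2 fun _ hx => (hs hx).2⟩,
      by rw [← Set.inter_union_distrib_left, Set.inter_eq_left.2 hsub]⟩
  refine ⟨VSet L A C, (subset_rad_vSet C).antisymm fun x hx => ?_⟩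
  by_contra hxC
  obtain ⟨U, hU, hxU, hCU⟩ := hC_irr.exists_mem_subbasis rfl hC hxC
  exact rad_vSet_subset_of_isRadicalIdeal hU hCU hx hxU
end

section
/- An L-structure A is equational noetherian (i.e., for every system S of atomic formulas there is a finite subsystem S₀ ⊆ S with V_A(S) = V_A(S₀)) if and only if for every natural number n, the Zariski topology on Aⁿ is a noetherian topological space (every descending chain of closed subsets stabilizes). -/
open FirstOrder

open TopologicalSpace in
theorem noetherianSpace_iff_isClosed_chain {X : Type*} [TopologicalSpace X] :
    NoetherianSpace X ↔ ∀ C : ℕ → Set X, (∀ i, IsClosed (C i)) → (∀ i, C (i + 1) ⊆ C i) →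
      ∃ N, ∀ m, N ≤ m → C m = C N := by
  rw [NoetherianSpace, wellFoundedGT_iff_monotone_chain_condition]
  constructor
  · intro h C hC hanti
    obtain ⟨N, hN⟩ := h ⟨fun i => ⟨(C i)ᶜ, (hC i).isOpen_compl⟩, monotone_nat_of_le_succ
      fun i => Set.compl_subset_compl.2 (hanti i)⟩
    exact ⟨N, fun m hm => compl_injective (congrArg SetLike.coe (hN m hm)).symm⟩
  · intro h f
    obtain ⟨N, hN⟩ := h (fun i => (f i : Set X)ᶜ) (fun i => (f i).isOpen.isClosed_compl)
      fun i => Set.compl_subset_compl.2 (f.monotone i.le_succ)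
    exact ⟨N, fun m hm => SetLike.coe_injective (compl_injective (hN m hm).symm)⟩

theorem vSet_eq_biInter (L : FirstOrder.Language) (A : Type*) [L.Structure A] {n : ℕ}
    (S : Set (L.Term (Fin n) × L.Term (Fin n))) :
    VSet L A S = ⋂ pq ∈ S, VSet L A {pq} := by
  ext a
  simp [VSet]

theorem isClosed_vSet (L : FirstOrder.Language) (A : Type*) [L.Structure A] {n : ℕ}
    (S : Set (L.Term (Fin n) × L.Term (Fin n))) :
    @IsClosed _ (zariskiTopology L A n) (VSet L A S) := by
  let _ := zariskiTopology L A n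
  exact isOpen_compl_iff.1 (TopologicalSpace.isOpen_generateFrom_of_mem ⟨S, compl_compl _⟩)

/-- If every system in `n` variables has a finite equivalent subsystem, then every subset of `Aⁿ`
is compact, by Alexander's subbasis theorem. -/
theorem isCompact_of_exists_finite_subsystem {L : FirstOrder.Language} {A : Type*} [L.Structure A]
    {n : ℕ} (h : ∀ S : Set (L.Term (Fin n) × L.Term (Fin n)),
      ∃ S₀ ⊆ S, S₀.Finite ∧ VSet L A S = VSet L A S₀) (s : Set (Fin n → A)) :
    @IsCompact _ (zariskiTopology L A n) s := by
  let _ := zariskiTopology L A n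
  refine isCompact_generateFrom rfl fun P hP hs => ?_
  obtain ⟨S₀, hS₀, hfin, hV⟩ := h (⋃ U ∈ P, Rad L A Uᶜ)
  have hmem : ∀ pq ∈ S₀, ∃ U ∈ P, pq ∈ Rad L A Uᶜ := fun pq hpq => by simpa using hS₀ hpq
  choose! f hfP hf using hmem
  refine ⟨f '' S₀, Set.image_subset_iff.2 hfP, hfin.image f, fun a ha => ?_⟩
  by_contra ha'
  have haV : a ∈ VSet L A S₀ := fun pq hpq =>
    hf pq hpq a fun haf => ha' ⟨f pq, Set.mem_image_of_mem f hpq, haf⟩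
  obtain ⟨U, hU, haU⟩ := hs ha
  obtain ⟨T, hT⟩ := hP hU
  rw [← hV] at haV
  have : a ∈ Uᶜ := hT ▸ fun pq hpq => haV pq
    (Set.mem_biUnion hU fun b hb => (hT ▸ hb : b ∈ VSet L A T) pq hpq)
  exact this haU

/-- If every subset of `Aⁿ` is compact, then every system in `n` variables has a finite
equivalent subsystem. -/
theorem exists_finite_subsystem_of_isCompact {L : FirstOrder.Language} {A : Type*} [L.Structure A]
    {n : ℕ} (h : ∀ s : Set (Fin n → A), @IsCompact _ (zariskiTopology L A n) s)
    (S : Set (L.Term (Fin n) × L.Term (Fin n))) :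
    ∃ S₀ ⊆ S, S₀.Finite ∧ VSet L A S = VSet L A S₀ := by
  let _ := zariskiTopology L A n
  obtain ⟨S₀, hS₀, hfin, hsub⟩ := (h (VSet L A S)ᶜ).elim_finite_subcover_image (b := S)
    (c := fun pq => (VSet L A {pq})ᶜ) (fun pq _ => (isClosed_vSet L A {pq}).isOpen_compl)
    (by rw [vSet_eq_biInter, Set.compl_iInter₂])
  refine ⟨S₀, hS₀, hfin, Set.Subset.antisymm (fun a ha pq hpq => ha pq (hS₀ hpq)) ?_⟩
  rwa [← Set.compl_iInter₂, ← vSet_eq_biInter, Set.compl_subset_compl] at hsub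

/-- `A` is equational noetherian iff for every `n` the Zariski topology on
`Aⁿ` is noetherian (every descending chain of closed sets stabilizes). -/
theorem equationalNoetherian_iff_zariski_noetherian
    {L : FirstOrder.Language} (A : Type*) [L.Structure A]
    (hL : ∀ k, IsEmpty (L.Relations k)) :
    (∀ (n : ℕ) (S : Set (L.Term (Fin n) × L.Term (Fin n))),
      ∃ S₀ ⊆ S, S₀.Finite ∧ VSet L A S = VSet L A S₀) ↔
    (∀ (n : ℕ) (C : ℕ → Set (Fin n → A)),
      (∀ i, @IsClosed _ (zariskiTopology L A n) (C i)) → (∀ i, C (i + 1) ⊆ C i) →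
      ∃ N, ∀ m, N ≤ m → C m = C N) := by
  refine forall_congr' fun n => ?_
  let _ := zariskiTopology L A n
  rw [← noetherianSpace_iff_isClosed_chain,
    ((TopologicalSpace.noetherianSpace_TFAE (Fin n → A)).out 0 2 :
      TopologicalSpace.NoetherianSpace (Fin n → A) ↔ ∀ s : Set (Fin n → A), IsCompact s)]
  exact ⟨isCompact_of_exists_finite_subsystem, exists_finite_subsystem_of_isCompact⟩
end

section
/- Let G be a finite group, regarded as a structure in the language of groups, and let A = G × G × ⋯ be the direct power of countably many copies of G (with pointwise operations). Then for any set I and any ultrafilter 𝒰 on I, the ultrapower A^I/𝒰 is equational Artinian. -/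
open FirstOrder

/-- The language of groups: one constant, one unary function symbol and one binary
function symbol, no relation symbols. -/
def groupLang : FirstOrder.Language where
  Functions n :=
    match n with
    | 0 => Unit
    | 1 => Unit
    | 2 => Unit
    | _ + 3 => Empty
  Relations _ := Empty

/-- Any group is a `groupLang`-structure in the natural way; in particular a direct
power `ℕ → G` of a group `G` carries the pointwise `groupLang`-structure. -/
instance groupLangStructure (G : Type*) [Group G] : groupLang.Structure G where
  funMap {n} f x :=
    match n, f, x with
    | 0, _, _ => 1
    | 1, _, x => (x 0)⁻¹
    | 2, _, x => x 0 * x 1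
    | _ + 3, f, _ => f.elim
  RelMap {n} r := r.elim

/-- If a finite invariant of terms determines their evaluation maps, there are finitely many
algebraic sets in each power, so every ascending chain of them stabilizes. -/
theorem EquationalArtinian.of_finite_invariant {L : FirstOrder.Language} {A : Type*}
    [L.Structure A] (F : ℕ → Type*) [∀ n, Finite (F n)]
    (f : ∀ n, L.Term (Fin n) → F n)
    (hf : ∀ n p q, f n p = f n q → ∀ a : Fin n → A, p.realize a = q.realize a) :
    EquationalArtinian L A := by
  intro n Y hY hmono
  let W : Set (F n × F n) → Set (Fin n → A) := fun T =>
    { a | ∀ pq : L.Term (Fin n) × L.Term (Fin n),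
      (f n pq.1, f n pq.2) ∈ T → pq.1.realize a = pq.2.realize a }
  have hrange : Set.range Y ⊆ Set.range W := by
    rintro _ ⟨i, rfl⟩
    obtain ⟨S, hS⟩ := hY i
    refine ⟨(fun pq => (f n pq.1, f n pq.2)) '' S, ?_⟩
    rw [hS]
    ext a
    constructor
    · exact fun h pq hpq => h pq ⟨pq, hpq, rfl⟩
    · rintro h pq ⟨rs, hrs, heq⟩
      obtain ⟨h₁, h₂⟩ := Prod.mk.inj heq
      rw [← hf n _ _ h₁ a, ← hf n _ _ h₂ a]
      exact h rs hrs
  have : Finite (Set.range Y) := ((Set.finite_range W).subset hrange).to_subtype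
  let Y' : ℕ →o Set.range Y :=
    ⟨Set.rangeFactorization Y, fun _ _ h => monotone_nat_of_le_succ hmono h⟩
  obtain ⟨N, hN⟩ := WellFoundedGT.monotone_chain_condition Y'
  exact ⟨N, fun m hm => (congrArg Subtype.val (hN m hm)).symm⟩

/-- Terms in the language of groups are evaluated coordinatewise in a power of a group. -/
theorem groupLang_realize_pi {G ι α : Type*} [Group G] (t : groupLang.Term α)
    (a : α → ι → G) (k : ι) : t.realize a k = t.realize fun j => a j k := by
  induction t with
  | var j => rfl
  | @func l g ts ih =>
    match l, g, ts, ih with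
    | 0, _, _, _ => rfl
    | 1, _, _, ih => exact congrArg (·⁻¹) (ih 0)
    | 2, _, _, ih => exact congrArg₂ (· * ·) (ih 0) (ih 1)
    | _ + 3, g, _, _ => exact g.elim

/-- An equation that holds identically in a structure holds identically in its ultrapowers. -/
theorem realize_eq_ultrapower {L : FirstOrder.Language} {A I α : Type*} [L.Structure A]
    [Nonempty A] (u : Ultrafilter I) {p q : L.Term α}
    (h : ∀ a : α → A, p.realize a = q.realize a)
    (a : α → (u : Filter I).Product fun _ : I => A) : p.realize a = q.realize a := by
  choose b hb using fun j => Quotient.exists_rep (a j)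
  obtain rfl := funext hb
  refine (FirstOrder.Language.Ultraproduct.term_realize_cast b p).trans
    (.trans ?_ (FirstOrder.Language.Ultraproduct.term_realize_cast b q).symm)
  exact congrArg (Quotient.mk (Filter.productSetoid u fun _ => A)) 
    (funext fun i => h fun j => b j i)

/-- for a finite group `G` and `A = G × G × ⋯` the direct power of
countably many copies of `G`, every ultrapower `A^I/𝒰` is equational Artinian. -/
theorem equationalArtinian_ultrapower_of_directPower_finite_group
    (G : Type*) [Group G] [Finite G] (I : Type*) (u : Ultrafilter I) :
    EquationalArtinian groupLang ((u : Filter I).Product fun _ : I => (ℕ → G)) := by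
  refine .of_finite_invariant (fun n => (Fin n → G) → G) (fun _ t a => t.realize a)
    fun _ _ _ h => realize_eq_ultrapower u fun a => funext fun k => ?_
  rw [groupLang_realize_pi, groupLang_realize_pi]
  exact congrFun h _
end
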